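/- Let (x₀, x₁) be uniformly distributed on {0,1}² and let Z be a box with binary input t and output x_t. With Ĥ defined as the minimum outcome Shannon entropy over fine-grained adaptive measurement strategies (so that Ĥ(X₀X₁Z) = 2, Ĥ(X₀Z) = Ĥ(X₁Z) = Ĥ(Z) = 1), define the conditional entropy Ĥ(A|B) := Ĥ(AB) − Ĥ(B). Then: (i) Ĥ(X₀|Z) = Ĥ(X₁|Z) = 0 while Ĥ(X₀X₁|Z) = 1 > 0 = Ĥ(X₀|Z) + Ĥ(X₁|Z), so subadditivity of the conditional entropy is violated; and (ii) Ĥ(X₀|X₁Z) = 1 > 0 = Ĥ(X₀|Z), so conditioning on the additional system X₁ strictly increases the conditional entropy. -/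

import Mathlib

open scoped BigOperators

/-- Shannon entropy (base 2) of a probability vector, with the convention `0 * log 0 = 0`. -/
noncomputable def shannonH {α : Type*} [Fintype α] (q : α → ℝ) : ℝ :=
  -∑ a, q a * Real.logb 2 (q a)

/-- `sel t x₀ x₁ = x_t`. -/
def sel (t x₀ x₁ : Bool) : Bool := bif t then x₁ else x₀

/-- Distribution of `(x₀, x₁, x_{f(x₀,x₁)})` with `(x₀,x₁)` uniform. -/
noncomputable def distX0X1Z (f : Bool → Bool → Bool) : Bool × Bool × Bool → ℝ :=
  fun o => if o.2.2 = sel (f o.1 o.2.1) o.1 o.2.1 then 1 / 4 else 0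

/-- Distribution of `(x₀, x_{f(x₀)})`. -/
noncomputable def distX0Z (f : Bool → Bool) : Bool × Bool → ℝ :=
  fun o => ∑ x₁ : Bool, if o.2 = sel (f o.1) o.1 x₁ then 1 / 4 else 0

/-- Distribution of `(x₁, x_{f(x₁)})`. -/
noncomputable def distX1Z (f : Bool → Bool) : Bool × Bool → ℝ :=
  fun o => ∑ x₀ : Bool, if o.2 = sel (f o.1) x₀ o.1 then 1 / 4 else 0

/-- Distribution of `x_t`. -/
noncomputable def distZ (t : Bool) : Bool → ℝ :=
  fun z => ∑ x₀ : Bool, ∑ x₁ : Bool, if z = sel t x₀ x₁ then 1 / 4 else 0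

/-- Measurement entropy `Ĥ(X₀X₁Z)`: min over adaptive fine-grained strategies. -/
noncomputable def hatH_X0X1Z : ℝ :=
  sInf { h : ℝ | ∃ f : Bool → Bool → Bool, h = shannonH (distX0X1Z f) }

noncomputable def hatH_X0Z : ℝ :=
  sInf { h : ℝ | ∃ f : Bool → Bool, h = shannonH (distX0Z f) }

noncomputable def hatH_X1Z : ℝ :=
  sInf { h : ℝ | ∃ f : Bool → Bool, h = shannonH (distX1Z f) }

noncomputable def hatH_Z : ℝ :=
  sInf { h : ℝ | ∃ t : Bool, h = shannonH (distZ t) }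

lemma logb_two_half : Real.logb 2 (1 / 2) = -1 := by
  rw [one_div, Real.logb_inv, Real.logb_self_eq_one one_lt_two]

lemma logb_two_quarter : Real.logb 2 (1 / 4) = -2 := by
  rw [show (1 / 4 : ℝ) = (1 / 2) ^ 2 by norm_num, Real.logb_pow, logb_two_half]
  norm_num

lemma shannonH_distX0X1Z (f : Bool → Bool → Bool) : shannonH (distX0X1Z f) = 2 := by
  have h := logb_two_quarter
  simp only [shannonH, distX0X1Z, Fintype.sum_prod_type, Fintype.sum_bool]
  cases f false false <;> cases f false true <;> cases f true false <;> cases f true true <;>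
    simp only [sel, cond_true, cond_false, if_true, if_false, reduceCtorEq, h, zero_mul] <;>
    norm_num

lemma shannonH_distX0Z (f : Bool → Bool) :
    shannonH (distX0Z f) = (if f false then 1 else 1 / 2) + (if f true then 1 else 1 / 2) := by
  have h := logb_two_quarter
  have h' := logb_two_half
  simp only [shannonH, distX0Z, Fintype.sum_prod_type, Fintype.sum_bool]
  cases f false <;> cases f true <;>
    simp only [sel, cond_true, cond_false, if_true, if_false, reduceCtorEq, h, zero_mul, add_zero,
      zero_add, show (1 / 4 + 1 / 4 : ℝ) = 1 / 2 by norm_num, h'] <;>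
    norm_num

lemma shannonH_distX1Z (f : Bool → Bool) :
    shannonH (distX1Z f) = (if f false then 1 / 2 else 1) + (if f true then 1 / 2 else 1) := by
  have h := logb_two_quarter
  have h' := logb_two_half
  simp only [shannonH, distX1Z, Fintype.sum_prod_type, Fintype.sum_bool]
  cases f false <;> cases f true <;>
    simp only [sel, cond_true, cond_false, if_true, if_false, reduceCtorEq, h, zero_mul, add_zero,
      zero_add, show (1 / 4 + 1 / 4 : ℝ) = 1 / 2 by norm_num, h'] <;>
    norm_num

lemma shannonH_distZ (t : Bool) : shannonH (distZ t) = 1 := by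
  have h' := logb_two_half
  simp only [shannonH, distZ, Fintype.sum_bool]
  cases t <;>
    simp only [sel, cond_true, cond_false, if_true, if_false, reduceCtorEq, add_zero,
      zero_add, show (1 / 4 + 1 / 4 : ℝ) = 1 / 2 by norm_num, h'] <;>
    norm_num

lemma hatH_X0X1Z_eq : hatH_X0X1Z = 2 := by
  refine IsLeast.csInf_eq ⟨⟨fun _ _ => false, (shannonH_distX0X1Z _).symm⟩, ?_⟩
  rintro _ ⟨f, rfl⟩
  exact (shannonH_distX0X1Z f).ge

lemma hatH_X0Z_eq : hatH_X0Z = 1 := by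
  refine IsLeast.csInf_eq ⟨⟨fun _ => false, ?_⟩, ?_⟩
  · rw [shannonH_distX0Z]
    norm_num
  · rintro _ ⟨f, rfl⟩
    rw [shannonH_distX0Z]
    split_ifs <;> norm_num

lemma hatH_X1Z_eq : hatH_X1Z = 1 := by
  refine IsLeast.csInf_eq ⟨⟨fun _ => true, ?_⟩, ?_⟩
  · rw [shannonH_distX1Z]
    norm_num
  · rintro _ ⟨f, rfl⟩
    rw [shannonH_distX1Z]
    split_ifs <;> norm_num

lemma hatH_Z_eq : hatH_Z = 1 := by
  refine IsLeast.csInf_eq ⟨⟨false, (shannonH_distZ _).symm⟩, ?_⟩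
  rintro _ ⟨t, rfl⟩
  exact (shannonH_distZ t).ge

/-- with the conditional entropy `Ĥ(A|B) := Ĥ(AB) − Ĥ(B)`, in box world:
(i) `Ĥ(X₀|Z) = Ĥ(X₁|Z) = 0` while `Ĥ(X₀X₁|Z) = 1 > 0 = Ĥ(X₀|Z) + Ĥ(X₁|Z)`
(subadditivity of conditional entropy fails); and
(ii) `Ĥ(X₀|X₁Z) = 1 > 0 = Ĥ(X₀|Z)` (conditioning on more can increase entropy). -/
theorem boxWorld_conditional_entropy_pathologies :
    hatH_X0Z - hatH_Z = 0 ∧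
    hatH_X1Z - hatH_Z = 0 ∧
    hatH_X0X1Z - hatH_Z = 1 ∧
    hatH_X0X1Z - hatH_Z > (hatH_X0Z - hatH_Z) + (hatH_X1Z - hatH_Z) ∧
    hatH_X0X1Z - hatH_X1Z = 1 ∧
    hatH_X0X1Z - hatH_X1Z > hatH_X0Z - hatH_Z := by
  rw [hatH_X0X1Z_eq, hatH_X0Z_eq, hatH_X1Z_eq, hatH_Z_eq]
  norm_num
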